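/- arXiv:math/9803095 — 3 statements merged into one kernel-verified Lean document; each statement's English description precedes it below -/
import Mathlib

section
/- Let q be a nonzero complex number with q² ≠ 1 and let X₀, X₊, X₋, C be linear operators on a complex vector space satisfying the sl(2)_q relations. Then for every integer k ≥ 0: X₀ X₋^k = X₋^k (q^{2k} X₀ − q^k [k]_q C). -/
/-- The quantum integer `[k]_q = (q^k - q^{-k})/(q - q⁻¹)`. -/
noncomputable def qint (q : ℂ) (k : ℤ) : ℂ := (q ^ k - q ^ (-k)) / (q - q⁻¹)

/-- Linear operators `X₀, X₊, X₋, C` satisfy the `sl(2)_q` relations. -/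
def SL2qRel (q : ℂ) {V : Type*} [AddCommGroup V] [Module ℂ V]
    (X0 Xp Xm C : Module.End ℂ V) : Prop :=
  q ^ 2 • (X0 * Xp) - Xp * X0 = q • (C * Xp) ∧
  (q ^ 2)⁻¹ • (X0 * Xm) - Xm * X0 = -(q⁻¹ • (C * Xm)) ∧
  Xp * Xm - Xm * Xp = (q + q⁻¹) • ((C - (q - q⁻¹) • X0) * X0) ∧
  C * X0 = X0 * C ∧ C * Xp = Xp * C ∧ C * Xm = Xm * C

theorem pow_mul_qint {q : ℂ} (hq : q ≠ 0) (k : ℕ) :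
    q ^ k * qint q k = (q ^ (2 * k) - 1) / (q - q⁻¹) := by
  have hk : q ^ k ≠ 0 := pow_ne_zero k hq
  rw [qint, zpow_neg, zpow_natCast, ← mul_div_assoc, mul_sub, mul_inv_cancel₀ hk, two_mul, pow_add]

theorem pow_succ_mul_qint_succ {q : ℂ} (hq : q ≠ 0) (hq2 : q ^ 2 ≠ 1) (k : ℕ) :
    q ^ (k + 1) * qint q (k + 1 : ℕ) = q ^ (2 * k) * q + q ^ k * qint q k := by
  have hl : q - q⁻¹ ≠ 0 := fun h => hq2 <| by
    rw [sq]
    nth_rewrite 2 [sub_eq_zero.mp h]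
    exact mul_inv_cancel₀ hq
  have hqq : q * (q - q⁻¹) = q ^ 2 - 1 := by rw [mul_sub, mul_inv_cancel₀ hq, sq]
  rw [pow_mul_qint hq, pow_mul_qint hq, div_eq_iff hl, add_mul, div_mul_cancel₀ _ hl, mul_assoc,
    hqq]
  ring

theorem SL2qRel.X0_mul_Xm {q : ℂ} (hq : q ≠ 0) {V : Type*} [AddCommGroup V] [Module ℂ V]
    {X0 Xp Xm C : Module.End ℂ V} (hrel : SL2qRel q X0 Xp Xm C) :
    X0 * Xm = Xm * (q ^ 2 • X0 - q • C) := by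
  obtain ⟨-, h, -, -, -, hC⟩ := hrel
  have h' := congrArg (q ^ 2 • ·) (sub_eq_iff_eq_add.mp h)
  have hqq : q ^ 2 * q⁻¹ = q := by field_simp
  simp only [smul_add, smul_neg, smul_smul, mul_inv_cancel₀ (pow_ne_zero 2 hq), one_smul, hqq,
    hC] at h'
  rw [h', mul_sub, mul_smul_comm, mul_smul_comm]
  abel

/-- `X₀ X₋^k = X₋^k (q^{2k} X₀ − q^k [k]_q C)` for all `k ≥ 0`. -/
theorem X0_mul_Xm_pow
    (q : ℂ) (hq : q ≠ 0) (hq2 : q ^ 2 ≠ 1)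
    (V : Type*) [AddCommGroup V] [Module ℂ V]
    (X0 Xp Xm C : Module.End ℂ V)
    (hrel : SL2qRel q X0 Xp Xm C) :
    ∀ k : ℕ, X0 * Xm ^ k = Xm ^ k * ((q ^ (2 * k) : ℂ) • X0 - (q ^ k * qint q k) • C) := by
  intro k
  induction k with
  | zero => simp [qint]
  | succ k ih =>
    rw [pow_succ, ← mul_assoc, ih, mul_assoc, mul_assoc, pow_succ_mul_qint_succ hq hq2]
    congr 1
    rw [sub_mul, smul_mul_assoc, smul_mul_assoc, hrel.X0_mul_Xm hq, hrel.2.2.2.2.2,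
      ← mul_smul_comm, ← mul_smul_comm, ← mul_sub]
    congr 1
    rw [mul_add, mul_one, pow_add]
    module
end

section
/- Let q be a nonzero complex number with q² ≠ 1 and let X₀, X₊, X₋, C be linear operators on a complex vector space satisfying the sl(2)_q relations. Then for every integer k ≥ 1: X₊X₋^k − X₋^k X₊ = X₋^{k−1} q^{2k−2} (C − λX₀)([2k]_q X₀ − q[k]_q[k−1]_q C). -/
theorem sub_inv_ne_zero_of_sq_ne_one {q : ℂ} (hq : q ≠ 0) (hq2 : q ^ 2 ≠ 1) : q - q⁻¹ ≠ 0 := by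
  intro h
  apply hq2
  field_simp at h
  linear_combination h

theorem qint_one {q : ℂ} (hq : q ≠ 0) (hq2 : q ^ 2 ≠ 1) : qint q 1 = 1 := by
  simp [qint, div_self (sub_inv_ne_zero_of_sq_ne_one hq hq2)]

theorem qint_zero (q : ℂ) : qint q 0 = 0 := by
  simp [qint]

theorem qint_two {q : ℂ} (hq : q ≠ 0) (hq2 : q ^ 2 ≠ 1) : qint q 2 = q + q⁻¹ := by
  rw [qint, div_eq_iff (sub_inv_ne_zero_of_sq_ne_one hq hq2), zpow_neg, zpow_ofNat]
  field_simp
  ring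

theorem zpow_mul_qint_two_mul_succ {q : ℂ} (hq : q ≠ 0) (hq2 : q ^ 2 ≠ 1) (k : ℤ) :
    q ^ (2 * k) * qint q (2 * (k + 1)) = q ^ (2 * k) * q ^ 2 * qint q (2 * k) + (q + q⁻¹) := by
  have hl := sub_inv_ne_zero_of_sq_ne_one hq hq2
  have ht : q ^ k ≠ 0 := zpow_ne_zero k hq
  apply mul_right_cancel₀ hl
  simp only [qint, add_mul, mul_assoc, div_mul_cancel₀ _ hl]
  simp only [mul_add, neg_add, two_mul, zpow_add₀ hq, zpow_neg, mul_one]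
  field_simp
  ring

theorem qint_succ_mul_qint {q : ℂ} (hq : q ≠ 0) (hq2 : q ^ 2 ≠ 1) (k : ℤ) :
    qint q (k + 1) * qint q k = qint q (2 * k) + qint q k * qint q (k - 1) := by
  have hl := sub_inv_ne_zero_of_sq_ne_one hq hq2
  have ht : q ^ k ≠ 0 := zpow_ne_zero k hq
  have key : (q ^ (k + 1) - q ^ (-(k + 1))) * (q ^ k - q ^ (-k)) =
      (q ^ (2 * k) - q ^ (-(2 * k))) * (q - q⁻¹) +
        (q ^ k - q ^ (-k)) * (q ^ (k - 1) - q ^ (-(k - 1))) := by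
    simp only [sub_eq_add_neg k, neg_add, neg_neg, two_mul, zpow_add₀ hq, zpow_neg, zpow_one]
    field_simp
    ring
  simp only [qint, div_mul_div_comm]
  rw [key, add_div, mul_div_mul_right _ _ hl]

namespace SL2qRel

variable {q : ℂ} {V : Type*} [AddCommGroup V] [Module ℂ V] {X0 Xp Xm C : Module.End ℂ V}

theorem X0_mul_Xm_s2 (hq : q ≠ 0) (h : SL2qRel q X0 Xp Xm C) :
    X0 * Xm = Xm * (q ^ 2 • X0 - q • C) := by
  obtain ⟨-, h, -, -, -, hC⟩ := h
  have h' := congrArg (fun A => q ^ 2 • A) h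
  simp only [smul_sub, smul_neg, smul_smul, mul_inv_cancel₀ (pow_ne_zero 2 hq), one_smul,
    show q ^ 2 * q⁻¹ = q by field_simp] at h'
  rw [mul_sub, mul_smul_comm, mul_smul_comm, ← hC, eq_add_of_sub_eq h']
  abel

theorem weight_mul_Xm (hq : q ≠ 0) (h : SL2qRel q X0 Xp Xm C) :
    (C - (q - q⁻¹) • X0) * Xm = Xm * (q ^ 2 • (C - (q - q⁻¹) • X0)) := by
  rw [sub_mul, smul_mul_assoc, h.X0_mul_Xm_s2 hq, h.2.2.2.2.2, ← mul_smul_comm, ← mul_sub]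
  congr 1
  match_scalars
  · field_simp
    ring
  · ring

theorem linear_mul_Xm (hq : q ≠ 0) (h : SL2qRel q X0 Xp Xm C) (a b : ℂ) :
    (a • X0 - b • C) * Xm = Xm * ((a * q ^ 2) • X0 - (a * q + b) • C) := by
  rw [sub_mul, smul_mul_assoc, smul_mul_assoc, h.X0_mul_Xm_s2 hq, h.2.2.2.2.2, ← mul_smul_comm,
    ← mul_smul_comm, ← mul_sub]
  congr 1
  module

end SL2qRel

/-- `[X₊, X₋^k] = X₋^{k−1} q^{2k−2} (C − λX₀)([2k]_q X₀ − q[k]_q[k−1]_q C)` for `k ≥ 1`. -/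
theorem Xp_comm_Xm_pow
    (q : ℂ) (hq : q ≠ 0) (hq2 : q ^ 2 ≠ 1)
    (V : Type*) [AddCommGroup V] [Module ℂ V]
    (X0 Xp Xm C : Module.End ℂ V)
    (hrel : SL2qRel q X0 Xp Xm C) :
    ∀ k : ℕ, 1 ≤ k →
      Xp * Xm ^ k - Xm ^ k * Xp =
        Xm ^ (k - 1) *
          (q ^ (2 * (k : ℤ) - 2) •
            ((C - (q - q⁻¹) • X0) *
              (qint q (2 * k) • X0 - (q * qint q k * qint q ((k : ℤ) - 1)) • C))) := by
  intro k hk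
  induction k, hk using Nat.le_induction with
  | base =>
    simp [qint_two hq hq2, qint_zero, hrel.2.2.1]
  | succ k hk ih =>
    obtain ⟨n, rfl⟩ : ∃ n, k = n + 1 := ⟨k - 1, by omega⟩
    simp only [Nat.add_sub_cancel] at ih ⊢
    generalize hm : n + 1 = m at ih ⊢
    have hX := zpow_mul_qint_two_mul_succ hq hq2 (m : ℤ)
    have hC := qint_succ_mul_qint hq hq2 (m : ℤ)
    have hpow : q ^ (2 * (m : ℤ) - 2) * q ^ 2 = q ^ (2 * (m : ℤ)) := by
      rw [← zpow_natCast q 2, ← zpow_add₀ hq]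
      congr 1
      push_cast
      ring
    have split : Xp * Xm ^ (m + 1) - Xm ^ (m + 1) * Xp =
        (Xp * Xm ^ m - Xm ^ m * Xp) * Xm + Xm ^ m * (Xp * Xm - Xm * Xp) := by
      rw [pow_succ]
      noncomm_ring
    rw [split, ih, hrel.2.2.1, mul_assoc, smul_mul_assoc, mul_assoc, hrel.linear_mul_Xm hq,
      ← mul_assoc (C - (q - q⁻¹) • X0), hrel.weight_mul_Xm hq, mul_assoc Xm, ← mul_smul_comm,
      ← mul_assoc, ← pow_succ, hm, ← mul_add]
    congr 1
    rw [smul_mul_assoc, smul_smul, hpow, ← mul_smul_comm, ← mul_smul_comm, ← mul_smul_comm,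
      ← mul_add]
    congr 1
    push_cast
    rw [show 2 * ((m : ℤ) + 1) - 2 = 2 * m by ring, add_sub_cancel_right]
    match_scalars
    · linear_combination -hX
    · linear_combination (q ^ (2 * (m : ℤ)) * q) * hC
end

section
/- Let q be a nonzero complex number that is generic (q^k ≠ 1 for every positive integer k), let c ∈ ℂ with c ≠ 0, let n ≥ 1 be an integer, and set μ' = −q[n]_q[n+1]_q c / [2n]_q. Then: (i) there is no integer m ≥ 1 with [2m]_q μ' = q[m]_q[m−1]_q c, and (ii) c ≠ λμ'. -/
theorem qint_two_mul (q : ℂ) (hq : q ≠ 0) (k : ℤ) :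
    qint q (2 * k) = qint q k * (q ^ k + q ^ (-k)) := by
  have h : q ^ (2 * k) = q ^ k * q ^ k := by rw [two_mul, zpow_add₀ hq]
  simp only [qint, zpow_neg, h, mul_inv]
  ring

theorem qint_ne_zero (q : ℂ) (hgen : ∀ k : ℕ, 0 < k → q ^ k ≠ 1) (hq : q ≠ 0)
    (n : ℕ) (hn : 1 ≤ n) : qint q n ≠ 0 := by
  have key : ∀ k : ℕ, 1 ≤ k → q ^ k - (q ^ k)⁻¹ ≠ 0 := by
    intro k hk h
    have h0 : q ^ k ≠ 0 := pow_ne_zero _ hq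
    refine hgen (k * 2) (by omega) ?_
    field_simp at h
    rw [pow_mul]
    linear_combination h
  have h1 := key 1 le_rfl
  rw [pow_one] at h1
  simpa only [qint, zpow_neg, zpow_natCast] using div_ne_zero (key n hn) h1

/-- For generic `q` the Verma module `V^{Λ'}` with highest weight
`μ' = −q[n]_q[n+1]_q c/[2n]_q` has no singular vectors: neither reducibility
condition can hold for `μ'`. -/
theorem shifted_verma_no_singular_vectors
    (q : ℂ) (hq : q ≠ 0) (hgen : ∀ k : ℕ, 0 < k → q ^ k ≠ 1)
    (c : ℂ) (hc : c ≠ 0) (n : ℕ) (hn : 1 ≤ n) (μ' : ℂ)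
    (hμ' : μ' = -(q * qint q n * qint q ((n : ℤ) + 1) * c / qint q (2 * n))) :
    (¬ ∃ m : ℕ, 1 ≤ m ∧
        qint q (2 * m) * μ' = q * qint q m * qint q ((m : ℤ) - 1) * c) ∧
      c ≠ (q - q⁻¹) * μ' := by
  have hnn := qint_ne_zero q hgen hq n hn
  have h2n : qint q (2 * n) ≠ 0 := by
    exact_mod_cast qint_ne_zero q hgen hq (2 * n) (by omega)
  have hx : q ^ n ≠ 0 := pow_ne_zero _ hq
  have hq2 : q ^ 2 + 1 ≠ 0 := fun h =>
    hgen 4 (by norm_num) (by linear_combination (q ^ 2 - 1) * h)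
  have hl : q - q⁻¹ ≠ 0 := by
    intro h
    field_simp at h
    exact hgen 2 (by norm_num) (by linear_combination h)
  have hμ : μ' * (q ^ n + (q ^ n)⁻¹) * (q - q⁻¹) =
      -(q * (q ^ n * q - (q ^ n * q)⁻¹) * c) := by
    have h1 : qint q ((n : ℤ) + 1) * (q - q⁻¹) = q ^ n * q - (q ^ n * q)⁻¹ := by
      rw [qint, div_mul_cancel₀ _ hl, zpow_neg, zpow_add₀ hq, zpow_natCast, zpow_one]
    have h2 : μ' * qint q (2 * n) = -(q * qint q n * qint q ((n : ℤ) + 1) * c) := by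
      rw [hμ', neg_mul, div_mul_cancel₀ _ h2n]
    rw [qint_two_mul q hq, zpow_neg, zpow_natCast] at h2
    refine mul_left_cancel₀ hnn ?_
    linear_combination (q - q⁻¹) * h2 - q * qint q n * c * h1
  constructor
  · rintro ⟨m, hm, h⟩
    have hy : q ^ m ≠ 0 := pow_ne_zero _ hq
    have h1 : qint q ((m : ℤ) - 1) * (q - q⁻¹) = q ^ m / q - (q ^ m / q)⁻¹ := by
      rw [qint, div_mul_cancel₀ _ hl, zpow_neg, zpow_sub₀ hq, zpow_natCast, zpow_one]
    have hm' : (q ^ m + (q ^ m)⁻¹) * μ' * (q - q⁻¹) =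
        q * (q ^ m / q - (q ^ m / q)⁻¹) * c := by
      rw [qint_two_mul q hq, zpow_neg, zpow_natCast] at h
      refine mul_left_cancel₀ (qint_ne_zero q hgen hq m hm) ?_
      linear_combination (q - q⁻¹) * h + q * qint q m * c * h1
    have e : q * c * ((q + q⁻¹) * (q ^ m * q ^ n - (q ^ m * q ^ n)⁻¹)) = 0 := by
      have : q * c * ((q + q⁻¹) * (q ^ m * q ^ n - (q ^ m * q ^ n)⁻¹)) =
          q * (q ^ m / q - (q ^ m / q)⁻¹) * c * (q ^ n + (q ^ n)⁻¹) +
          q * (q ^ n * q - (q ^ n * q)⁻¹) * c * (q ^ m + (q ^ m)⁻¹) := by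
        field_simp
        ring
      rw [this]
      linear_combination (q ^ m + (q ^ m)⁻¹) * hμ - (q ^ n + (q ^ n)⁻¹) * hm'
    have e1 : (q ^ 2 + 1) * ((q ^ m * q ^ n) ^ 2 - 1) = 0 := by
      have e2 := (mul_eq_zero.mp e).resolve_left (mul_ne_zero hq hc)
      generalize q ^ m = y at *
      generalize q ^ n = x at *
      have : (q ^ 2 + 1) * ((y * x) ^ 2 - 1) =
          q * (y * x) * ((q + q⁻¹) * (y * x - (y * x)⁻¹)) := by
        field_simp
      rw [this, e2, mul_zero]
    refine hgen ((m + n) * 2) (by omega) ?_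
    rw [pow_mul, pow_add]
    exact sub_eq_zero.mp ((mul_eq_zero.mp e1).resolve_left hq2)
  · intro h
    have e : c * (q ^ n * (q ^ 2 + 1)) = 0 := by
      have : c * (q ^ n * (q ^ 2 + 1)) =
          c * (q ^ n + (q ^ n)⁻¹) + q * (q ^ n * q - (q ^ n * q)⁻¹) * c := by
        field_simp
        ring
      rw [this]
      linear_combination (q ^ n + (q ^ n)⁻¹) * h + hμ
    exact mul_ne_zero hc (mul_ne_zero hx hq2) e
end
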